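/- arXiv:2509.13209 — 6 statements merged into one kernel-verified Lean document; each statement's English description precedes it below -/
import Mathlib

section
/- Let A be a finite set, u : A → ℝ with u_a ≥ 0, τ ∈ ℕ with τ ≤ |A|, and for each a ∈ A let φ_a : ℝ → ℝ be a function. Suppose for each a ∈ A a point y*_a ∈ [0, u_a] satisfies φ_a(y*_a) ≤ φ_a(y) for all y ∈ [0, u_a]. Let Ā ⊆ A be a subset with |Ā| = τ such that φ_a(y*_a) − φ_a(0) ≤ φ_b(y*_b) − φ_b(0) for every a ∈ Ā and every b ∈ A \ Ā (i.e., Ā indexes τ smallest values of φ_a(y*_a) − φ_a(0)). Define ȳ* ∈ ℝ^A by ȳ*_a = y*_a if a ∈ Ā and ȳ*_a = 0 otherwise. Then ȳ* ∈ Υ_τ and Σ_{a∈A} φ_a(ȳ*_a) ≤ Σ_{a∈A} φ_a(y_a) for every y ∈ Υ_τ; that is, ȳ* is a global minimizer of y ↦ Σ_{a∈A} φ_a(y_a) over Υ_τ. -/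
/-- A finset selecting smallest values of a nonpositive function has the least sum among all
finsets of at most the same cardinality. -/
theorem Finset.sum_le_sum_of_card_le_of_forall_le {A : Type*} [DecidableEq A] {d : A → ℝ}
    (hd : ∀ a, d a ≤ 0) {s t : Finset A} (hcard : t.card ≤ s.card)
    (hsel : ∀ a ∈ s, ∀ b ∉ s, d a ≤ d b) : ∑ a ∈ s, d a ≤ ∑ a ∈ t, d a := by
  rw [← Finset.sum_sdiff_le_sum_sdiff]
  rcases (t \ s).eq_empty_or_nonempty with h | h
  · rw [h, Finset.sum_empty]
    exact Finset.sum_nonpos fun a _ => hd a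
  · obtain ⟨b, hb, hbmin⟩ := Finset.exists_min_image (t \ s) d h
    calc ∑ a ∈ s \ t, d a ≤ (s \ t).card • d b :=
          Finset.sum_le_card_nsmul _ _ _ fun a ha =>
            hsel a (Finset.mem_sdiff.1 ha).1 b (Finset.mem_sdiff.1 hb).2
      _ ≤ (t \ s).card • d b := by
          rw [nsmul_eq_mul, nsmul_eq_mul]
          exact mul_le_mul_of_nonpos_right
            (Nat.cast_le.2 (Finset.card_sdiff_le_card_sdiff_iff.2 hcard)) (hd b)
      _ ≤ ∑ a ∈ t \ s, d a := Finset.card_nsmul_le_sum _ _ _ hbmin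

/-- Proposition 4 (closed-form minimization of a separable function over the
cardinality-constrained set `Υ_τ`): if `y*_a` minimizes `φ_a` over `[0, u_a]`
for each `a`, and `Ā` indexes `τ` smallest values of `φ_a(y*_a) − φ_a(0)`, then
`ȳ*` (equal to `y*` on `Ā` and `0` off `Ā`) is a global minimizer of
`y ↦ Σ_a φ_a(y_a)` over `Υ_τ`. -/
theorem separable_min_over_cardinality_set {A : Type*} [Fintype A] [DecidableEq A]
    (u : A → ℝ) (hu : ∀ a, 0 ≤ u a) (τ : ℕ) (hτ : τ ≤ Fintype.card A)
    (φ : A → ℝ → ℝ)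
    (ystar : A → ℝ) (hmem : ∀ a, ystar a ∈ Set.Icc 0 (u a))
    (hmin : ∀ a, ∀ z ∈ Set.Icc 0 (u a), φ a (ystar a) ≤ φ a z)
    (Abar : Finset A) (hcard : Abar.card = τ)
    (hsel : ∀ a ∈ Abar, ∀ b ∉ Abar, φ a (ystar a) - φ a 0 ≤ φ b (ystar b) - φ b 0)
    (ybar : A → ℝ) (hybar : ∀ a, ybar a = if a ∈ Abar then ystar a else 0) :
    ybar ∈ {y : A → ℝ | (∀ a, 0 ≤ y a ∧ y a ≤ u a) ∧ (Function.support y).ncard ≤ τ} ∧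
      ∀ y ∈ {y : A → ℝ | (∀ a, 0 ≤ y a ∧ y a ≤ u a) ∧ (Function.support y).ncard ≤ τ},
        ∑ a, φ a (ybar a) ≤ ∑ a, φ a (y a) := by
  have hd (a : A) : φ a (ystar a) - φ a 0 ≤ 0 :=
    sub_nonpos.2 (hmin a 0 ⟨le_rfl, hu a⟩)
  refine ⟨⟨fun a => ?_, ?_⟩, ?_⟩
  · rw [hybar]
    split_ifs
    exacts [hmem a, ⟨le_rfl, hu a⟩]
  · rw [← hcard, ← Set.ncard_coe_finset]
    refine Set.ncard_le_ncard (fun a ha => ?_) Abar.finite_toSet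
    by_contra h
    exact ha ((hybar a).trans (if_neg h))
  · rintro y ⟨hy, hsupp⟩
    let t : Finset A := {a | y a ≠ 0}
    have ht : t.card ≤ Abar.card := by
      rw [hcard, ← Set.ncard_coe_finset]
      simpa [t, Function.support] using hsupp
    calc ∑ a, φ a (ybar a)
        = ∑ a, φ a 0 + ∑ a ∈ Abar, (φ a (ystar a) - φ a 0) := by
          rw [← Finset.sum_ite_mem_eq Abar, ← Finset.sum_add_distrib]
          refine Finset.sum_congr rfl fun a _ => ?_
          rw [hybar]
          split_ifs <;> ring
      _ ≤ ∑ a, φ a 0 + ∑ a ∈ t, (φ a (ystar a) - φ a 0) :=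
          add_le_add le_rfl (Finset.sum_le_sum_of_card_le_of_forall_le hd ht hsel)
      _ ≤ ∑ a, φ a (y a) := by
          rw [← Finset.sum_ite_mem_eq t, ← Finset.sum_add_distrib]
          refine Finset.sum_le_sum fun a _ => ?_
          by_cases h : y a = 0
          · simp [t, h]
          · simpa [t, h] using hmin a (y a) (hy a)
end

section
/- Let Y ⊆ ℝ^n and V ⊆ ℝ^m be nonempty compact sets and Ψ : ℝ^n × ℝ^m → ℝ be continuous. Suppose that for every y ∈ Y the minimizer of v ↦ Ψ(y, v) over V is unique. Let (y^j)_{j≥0} ⊆ Y and (v^j)_{j≥0} ⊆ V be sequences such that for every j ≥ 0: Ψ(y^j, v^{j+1}) ≤ Ψ(y^j, v) for all v ∈ V, and Ψ(y^{j+1}, v^{j+1}) ≤ Ψ(y, v^{j+1}) for all y ∈ Y. If for every j ≥ 0 the pair (y^j, v^j) is NOT partially optimal for Ψ on Y × V, then the value sequence is strictly decreasing: Ψ(y^{j+1}, v^{j+1}) < Ψ(y^j, v^j) for every j ≥ 0. -/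
/-- Theorem 1 (strict decrease): under alternating exact minimization with a
unique inner minimizer, if no iterate `(y^j, v^j)` is partially optimal, the
value sequence is strictly decreasing. -/
theorem alternating_min_values_strict_decrease {n m : ℕ}
    (Y : Set (EuclideanSpace ℝ (Fin n))) (V : Set (EuclideanSpace ℝ (Fin m)))
    (hY : IsCompact Y) (hYne : Y.Nonempty) (hV : IsCompact V) (hVne : V.Nonempty)
    (Ψ : EuclideanSpace ℝ (Fin n) → EuclideanSpace ℝ (Fin m) → ℝ)
    (hΨ : Continuous fun p : EuclideanSpace ℝ (Fin n) × EuclideanSpace ℝ (Fin m) => Ψ p.1 p.2)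
    (huniq : ∀ y' ∈ Y, ∀ v₁ ∈ V, ∀ v₂ ∈ V,
      (∀ v' ∈ V, Ψ y' v₁ ≤ Ψ y' v') → (∀ v' ∈ V, Ψ y' v₂ ≤ Ψ y' v') → v₁ = v₂)
    (y : ℕ → EuclideanSpace ℝ (Fin n)) (v : ℕ → EuclideanSpace ℝ (Fin m))
    (hy : ∀ j, y j ∈ Y) (hv : ∀ j, v j ∈ V)
    (hstepv : ∀ j, ∀ v' ∈ V, Ψ (y j) (v (j + 1)) ≤ Ψ (y j) v')
    (hstepy : ∀ j, ∀ y' ∈ Y, Ψ (y (j + 1)) (v (j + 1)) ≤ Ψ y' (v (j + 1)))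
    (hnotpo : ∀ j, ¬ ((∀ v' ∈ V, Ψ (y j) (v j) ≤ Ψ (y j) v') ∧
      (∀ y' ∈ Y, Ψ (y j) (v j) ≤ Ψ y' (v j)))) :
    ∀ j, Ψ (y (j + 1)) (v (j + 1)) < Ψ (y j) (v j) := by
  intro j
  by_contra! hle
  have hstay : Ψ (y j) (v j) ≤ Ψ (y j) (v (j + 1)) := hle.trans (hstepy j _ (hy j))
  have hmin : ∀ v' ∈ V, Ψ (y j) (v j) ≤ Ψ (y j) v' :=
    fun v' hv' => hstay.trans (hstepv j v' hv')
  have heq : v j = v (j + 1) :=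
    huniq _ (hy j) _ (hv j) _ (hv (j + 1)) hmin (hstepv j)
  refine hnotpo j ⟨hmin, fun y' hy' => ?_⟩
  calc Ψ (y j) (v j) ≤ Ψ (y (j + 1)) (v (j + 1)) := hle
    _ ≤ Ψ y' (v (j + 1)) := hstepy j y' hy'
    _ = Ψ y' (v j) := by rw [heq]
end

section
/- Let Y ⊆ ℝ^n and V ⊆ ℝ^m be nonempty compact sets and Ψ : ℝ^n × ℝ^m → ℝ be continuous. Suppose that for every y ∈ Y the minimizer of v ↦ Ψ(y, v) over V is unique. Let (y^j)_{j≥0} ⊆ Y and (v^j)_{j≥0} ⊆ V satisfy, for every j ≥ 0: Ψ(y^j, v^{j+1}) ≤ Ψ(y^j, v) for all v ∈ V, and Ψ(y^{j+1}, v^{j+1}) ≤ Ψ(y, v^{j+1}) for all y ∈ Y. Then every accumulation point (y*, v*) of the sequence ((y^j, v^j))_{j≥1} is partially optimal for Ψ on Y × V, i.e., Ψ(y*, v*) ≤ Ψ(y*, v) for all v ∈ V and Ψ(y*, v*) ≤ Ψ(y, v*) for all y ∈ Y. -/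
open Filter Topology

section AlternatingMinimization

variable {E F : Type*} {Y : Set E} {V : Set F} {Ψ : E → F → ℝ} {y : ℕ → E} {v : ℕ → F}

/-- Alternating minimization never increases the objective. -/
theorem antitone_alternating_min (hy : ∀ j, y j ∈ Y) (hv : ∀ j, v j ∈ V)
    (hstepv : ∀ j, ∀ v' ∈ V, Ψ (y j) (v (j + 1)) ≤ Ψ (y j) v')
    (hstepy : ∀ j, ∀ y' ∈ Y, Ψ (y (j + 1)) (v (j + 1)) ≤ Ψ y' (v (j + 1))) :
    Antitone fun j => Ψ (y j) (v j) :=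
  antitone_nat_of_succ_le fun j => (hstepy j _ (hy j)).trans (hstepv j _ (hv j))

variable [TopologicalSpace E] [TopologicalSpace F] {a : E} {b : F} {φ : ℕ → ℕ}

/-- A subsequential limit of alternating minimization is optimal in the first-minimized block. -/
theorem le_of_tendsto_alternating_min_left (hΨ : Continuous fun p : E × F => Ψ p.1 p.2)
    (hy : ∀ j, y j ∈ Y) (hv : ∀ j, v j ∈ V)
    (hstepv : ∀ j, ∀ v' ∈ V, Ψ (y j) (v (j + 1)) ≤ Ψ (y j) v')
    (hstepy : ∀ j, ∀ y' ∈ Y, Ψ (y (j + 1)) (v (j + 1)) ≤ Ψ y' (v (j + 1)))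
    (hφ : StrictMono φ) (hacc : Tendsto (fun j => (y (φ j), v (φ j))) atTop (𝓝 (a, b)))
    {v' : F} (hv' : v' ∈ V) : Ψ a b ≤ Ψ a v' := by
  have hanti := antitone_alternating_min hy hv hstepv hstepy
  have hlim : Tendsto (fun j => Ψ (y (φ j)) (v (φ j))) atTop (𝓝 (Ψ a b)) :=
    (hΨ.tendsto (a, b)).comp hacc
  have hlim' : Tendsto (fun j => Ψ (y (φ j)) v') atTop (𝓝 (Ψ a v')) :=
    (hΨ.tendsto (a, v')).comp (hacc.fst_nhds.prodMk_nhds tendsto_const_nhds)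
  refine ge_of_tendsto' hlim' fun j => ?_
  calc Ψ a b ≤ Ψ (y (φ (j + 1))) (v (φ (j + 1))) :=
        (hanti.comp_monotone hφ.monotone).le_of_tendsto hlim (j + 1)
    _ ≤ Ψ (y (φ j + 1)) (v (φ j + 1)) := hanti (hφ j.lt_succ_self)
    _ ≤ Ψ (y (φ j)) (v (φ j + 1)) := hstepy _ _ (hy _)
    _ ≤ Ψ (y (φ j)) v' := hstepv _ _ hv'

/-- A subsequential limit of alternating minimization is optimal in the last-minimized block. -/
theorem le_of_tendsto_alternating_min_right (hΨ : Continuous fun p : E × F => Ψ p.1 p.2)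
    (hstepy : ∀ j, ∀ y' ∈ Y, Ψ (y (j + 1)) (v (j + 1)) ≤ Ψ y' (v (j + 1)))
    (hφ1 : ∀ j, 1 ≤ φ j) (hacc : Tendsto (fun j => (y (φ j), v (φ j))) atTop (𝓝 (a, b)))
    {y' : E} (hy' : y' ∈ Y) : Ψ a b ≤ Ψ y' b := by
  have hlim : Tendsto (fun j => Ψ (y (φ j)) (v (φ j))) atTop (𝓝 (Ψ a b)) :=
    (hΨ.tendsto (a, b)).comp hacc
  have hlim' : Tendsto (fun j => Ψ y' (v (φ j))) atTop (𝓝 (Ψ y' b)) :=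
    (hΨ.tendsto (y', b)).comp (tendsto_const_nhds.prodMk_nhds hacc.snd_nhds)
  refine le_of_tendsto_of_tendsto' hlim hlim' fun j => ?_
  simpa only [Nat.sub_add_cancel (hφ1 j)] using hstepy (φ j - 1) y' hy'

end AlternatingMinimization


/-- Theorem 1-(iii): under alternating exact minimization with a unique inner
minimizer, every accumulation point `(y*, v*)` of the iterate sequence is a
partially optimal solution. -/
theorem alternating_min_accumulation_partially_optimal {n m : ℕ}
    (Y : Set (EuclideanSpace ℝ (Fin n))) (V : Set (EuclideanSpace ℝ (Fin m)))
    (hY : IsCompact Y) (hYne : Y.Nonempty) (hV : IsCompact V) (hVne : V.Nonempty)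
    (Ψ : EuclideanSpace ℝ (Fin n) → EuclideanSpace ℝ (Fin m) → ℝ)
    (hΨ : Continuous fun p : EuclideanSpace ℝ (Fin n) × EuclideanSpace ℝ (Fin m) => Ψ p.1 p.2)
    (huniq : ∀ y' ∈ Y, ∀ v₁ ∈ V, ∀ v₂ ∈ V,
      (∀ v' ∈ V, Ψ y' v₁ ≤ Ψ y' v') → (∀ v' ∈ V, Ψ y' v₂ ≤ Ψ y' v') → v₁ = v₂)
    (y : ℕ → EuclideanSpace ℝ (Fin n)) (v : ℕ → EuclideanSpace ℝ (Fin m))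
    (hy : ∀ j, y j ∈ Y) (hv : ∀ j, v j ∈ V)
    (hstepv : ∀ j, ∀ v' ∈ V, Ψ (y j) (v (j + 1)) ≤ Ψ (y j) v')
    (hstepy : ∀ j, ∀ y' ∈ Y, Ψ (y (j + 1)) (v (j + 1)) ≤ Ψ y' (v (j + 1)))
    (ystar : EuclideanSpace ℝ (Fin n)) (vstar : EuclideanSpace ℝ (Fin m))
    (φ : ℕ → ℕ) (hφ : StrictMono φ) (hφ1 : ∀ j, 1 ≤ φ j)
    (hacc : Filter.Tendsto (fun j => (y (φ j), v (φ j))) Filter.atTop (nhds (ystar, vstar))) :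
    (∀ v' ∈ V, Ψ ystar vstar ≤ Ψ ystar v') ∧ (∀ y' ∈ Y, Ψ ystar vstar ≤ Ψ y' vstar) :=
  ⟨fun _ hv' => le_of_tendsto_alternating_min_left hΨ hy hv hstepv hstepy hφ hacc hv',
    fun _ hy' => le_of_tendsto_alternating_min_right hΨ hstepy hφ1 hacc hy'⟩
end

section
/- Let t₀ > 0 and c > 0. The BPR Beckmann integrand primitive, namely the function (y, v) ↦ ∫₀^v t₀·(1 + 0.15·(w/(c + y))⁴) dw = t₀·(v + 0.03·v⁵/(c + y)⁴), is convex on the set {(y, v) ∈ ℝ² : y ≥ 0, v ≥ 0}. -/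
/-- The perspective of `x ↦ x ^ (n + 1)` is jointly convex. -/
theorem convexOn_pow_succ_div_pow (n : ℕ) :
    ConvexOn ℝ {p : ℝ × ℝ | 0 < p.1 ∧ 0 ≤ p.2} (fun p : ℝ × ℝ => p.2 ^ (n + 1) / p.1 ^ n) := by
  refine ⟨((convex_Ioi (0 : ℝ)).prod (convex_Ici (0 : ℝ))), ?_⟩
  rintro ⟨z₁, v₁⟩ ⟨hz₁, hv₁⟩ ⟨z₂, v₂⟩ ⟨hz₂, hv₂⟩ a b ha hb hab
  simp only [Prod.smul_mk, Prod.mk_add_mk, smul_eq_mul] at *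
  have hz : 0 < a * z₁ + b * z₂ := (convex_Ioi (0 : ℝ)) hz₁ hz₂ ha hb hab
  have key := (convexOn_pow (𝕜 := ℝ) (n + 1)).2
    (Set.mem_Ici.2 (div_nonneg hv₁ hz₁.le)) (Set.mem_Ici.2 (div_nonneg hv₂ hz₂.le))
    (show 0 ≤ a * z₁ / (a * z₁ + b * z₂) by positivity)
    (show 0 ≤ b * z₂ / (a * z₁ + b * z₂) by positivity) (by field_simp)
  simp only [smul_eq_mul] at key
  generalize hZ : a * z₁ + b * z₂ = Z at *
  have h := mul_le_mul_of_nonneg_left key hz.le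
  calc (a * v₁ + b * v₂) ^ (n + 1) / Z ^ n
      = Z * (a * z₁ / Z * (v₁ / z₁) + b * z₂ / Z * (v₂ / z₂)) ^ (n + 1) := by
        have : a * z₁ / Z * (v₁ / z₁) + b * z₂ / Z * (v₂ / z₂) = (a * v₁ + b * v₂) / Z := by
          field_simp
        rw [this, div_pow, pow_succ Z]
        field_simp
    _ ≤ Z * (a * z₁ / Z * (v₁ / z₁) ^ (n + 1) + b * z₂ / Z * (v₂ / z₂) ^ (n + 1)) := h
    _ = a * (v₁ ^ (n + 1) / z₁ ^ n) + b * (v₂ ^ (n + 1) / z₂ ^ n) := by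
        rw [div_pow v₁, div_pow v₂, pow_succ z₁, pow_succ z₂]
        field_simp

theorem integral_bpr (t₀ c y v : ℝ) :
    (∫ w in (0:ℝ)..v, t₀ * (1 + 0.15 * (w / (c + y)) ^ 4)) =
      t₀ * (v + 0.03 * v ^ 5 / (c + y) ^ 4) := by
  simp only [div_pow]
  rw [intervalIntegral.integral_const_mul, intervalIntegral.integral_add
    (Continuous.intervalIntegrable (by fun_prop) _ _)
    (Continuous.intervalIntegrable (by fun_prop) _ _),
    intervalIntegral.integral_const_mul, intervalIntegral.integral_div, integral_pow]
  simp only [intervalIntegral.integral_const, smul_eq_mul]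
  ring

/-- The BPR Beckmann primitive
`(y, v) ↦ ∫₀^v t₀·(1 + 0.15·(w/(c + y))⁴) dw = t₀·(v + 0.03·v⁵/(c + y)⁴)`
is convex on `{(y, v) : y ≥ 0, v ≥ 0}`. -/
theorem convexOn_bpr_beckmann_primitive (t₀ c : ℝ) (ht₀ : 0 < t₀) (hc : 0 < c) :
    (∀ y v : ℝ, (∫ w in (0:ℝ)..v, t₀ * (1 + 0.15 * (w / (c + y)) ^ 4)) =
        t₀ * (v + 0.03 * v ^ 5 / (c + y) ^ 4)) ∧
      ConvexOn ℝ {p : ℝ × ℝ | 0 ≤ p.1 ∧ 0 ≤ p.2}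
        (fun p : ℝ × ℝ => ∫ w in (0:ℝ)..p.2, t₀ * (1 + 0.15 * (w / (c + p.1)) ^ 4)) := by
  refine ⟨integral_bpr t₀ c, ?_⟩
  simp only [integral_bpr]
  have hs : Convex ℝ {p : ℝ × ℝ | 0 ≤ p.1 ∧ 0 ≤ p.2} :=
    (convex_Ici (0 : ℝ)).prod (convex_Ici (0 : ℝ))
  have h : ConvexOn ℝ {p : ℝ × ℝ | 0 ≤ p.1 ∧ 0 ≤ p.2}
      (fun p : ℝ × ℝ => p.2 ^ 5 / (c + p.1) ^ 4) := by
    refine (((convexOn_pow_succ_div_pow 4).translate_right (c, 0)).subset ?_ hs).congr ?_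
    · rintro ⟨y, v⟩ ⟨hy, hv⟩
      exact ⟨add_pos_of_pos_of_nonneg hc hy, by simpa using hv⟩
    · intro p _
      simp
  have hv : ConvexOn ℝ {p : ℝ × ℝ | 0 ≤ p.1 ∧ 0 ≤ p.2} (fun p : ℝ × ℝ => p.2) :=
    (LinearMap.snd ℝ ℝ ℝ).convexOn hs
  refine ((hv.add (h.smul (c := 0.03) (by norm_num))).smul ht₀.le).congr ?_
  intro p _
  simp [mul_div_assoc]
end

section
/- Let t₀ > 0 and c > 0. The BPR total link cost function, namely (y, v) ↦ v·t₀·(1 + 0.15·(v/(c + y))⁴) = t₀·(v + 0.15·v⁵/(c + y)⁴), is convex on the set {(y, v) ∈ ℝ² : y ≥ 0, v ≥ 0}. -/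
/-- The tangent planes of the perspective `(v, w) ↦ v * (v / w) ^ 4` of the fifth power
lie below its graph. -/
theorem tangent_le_mul_div_pow_four {v w s : ℝ} (hv : 0 ≤ v) (hw : 0 < w) (hs : 0 ≤ s) :
    5 * s ^ 4 * v - 4 * s ^ 5 * w ≤ v * (v / w) ^ 4 := by
  obtain ⟨r, hr⟩ : ∃ r, r = v / w := ⟨_, rfl⟩
  have hr0 : 0 ≤ r := hr ▸ div_nonneg hv hw.le
  have hvr : v = r * w := by rw [hr, div_mul_cancel₀ v hw.ne']
  rw [← hr, hvr]
  have h : 0 ≤ w * ((r - s) ^ 2 * (r ^ 3 + 2 * r ^ 2 * s + 3 * r * s ^ 2 + 4 * s ^ 3)) := by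
    positivity
  linarith

/-- The BPR total link cost function
`(y, v) ↦ v·t₀·(1 + 0.15·(v/(c + y))⁴)` is convex on `{(y, v) : y ≥ 0, v ≥ 0}`. -/
theorem convexOn_bpr_total_cost (t₀ c : ℝ) (ht₀ : 0 < t₀) (hc : 0 < c) :
    ConvexOn ℝ {p : ℝ × ℝ | 0 ≤ p.1 ∧ 0 ≤ p.2}
      (fun p : ℝ × ℝ => p.2 * (t₀ * (1 + 0.15 * (p.2 / (c + p.1)) ^ 4))) := by
  have hset : {p : ℝ × ℝ | 0 ≤ p.1 ∧ 0 ≤ p.2} = Set.Ici 0 := by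
    ext p
    simp [Prod.le_def]
  refine ⟨hset ▸ convex_Ici 0, ?_⟩
  rintro ⟨y₁, v₁⟩ ⟨hy₁, hv₁⟩ ⟨y₂, v₂⟩ ⟨hy₂, hv₂⟩ a b ha hb hab
  simp only [Prod.smul_mk, Prod.mk_add_mk, smul_eq_mul] at hy₁ hv₁ hy₂ hv₂ ⊢
  have hW : 0 < c + (a * y₁ + b * y₂) := by positivity
  have hV : 0 ≤ a * v₁ + b * v₂ := by positivity
  obtain ⟨s, hs⟩ : ∃ s, s = (a * v₁ + b * v₂) / (c + (a * y₁ + b * y₂)) := ⟨_, rfl⟩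
  have hs0 : 0 ≤ s := hs ▸ div_nonneg hV hW.le
  have hVs : a * v₁ + b * v₂ = s * (c + (a * y₁ + b * y₂)) := by
    rw [hs, div_mul_cancel₀ _ hW.ne']
  have h₁ := mul_le_mul_of_nonneg_left
    (tangent_le_mul_div_pow_four hv₁ (by positivity : 0 < c + y₁) hs0) ha
  have h₂ := mul_le_mul_of_nonneg_left
    (tangent_le_mul_div_pow_four hv₂ (by positivity : 0 < c + y₂) hs0) hb
  rw [← hs]
  have key : (a * v₁ + b * v₂) * s ^ 4 ≤
      a * (v₁ * (v₁ / (c + y₁)) ^ 4) + b * (v₂ * (v₂ / (c + y₂)) ^ 4) := by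
    refine le_trans (le_of_eq ?_) (add_le_add h₁ h₂)
    linear_combination (-4 * s ^ 4) * hVs + (4 * s ^ 5 * c) * hab
  linarith [mul_le_mul_of_nonneg_left key ht₀.le]
end

section
/- Let V ⊆ ℝ^m be a nonempty compact set and let f : ℝ^n × ℝ^m → ℝ be continuously differentiable. Suppose that for every y ∈ ℝ^n the minimizer of v ↦ f(y, v) over V is unique; denote it v(y). Then the value function g(y) = min_{v ∈ V} f(y, v) is continuously differentiable on ℝ^n with gradient ∇g(y) = ∇_y f(y, v(y)) for every y, where ∇_y f denotes the partial gradient of f with respect to its first argument. -/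
section EnvelopeTheorem

open Filter Topology Asymptotics

/-- A selection of unique minimizers over a compact set is continuous. -/
theorem continuous_of_unique_minimizer {X Y : Type*} [TopologicalSpace X] [TopologicalSpace Y]
    {V : Set Y} (hV : IsCompact V) {f : X × Y → ℝ} (hf : Continuous f) {w : X → Y}
    (hwV : ∀ x, w x ∈ V) (hwmin : ∀ x, ∀ v ∈ V, f (x, w x) ≤ f (x, v))
    (huniq : ∀ x, ∀ v ∈ V, (∀ v' ∈ V, f (x, v) ≤ f (x, v')) → v = w x) :
    Continuous w := by
  refine continuous_iff_continuousAt.2 fun x => ?_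
  refine hV.tendsto_nhds_of_unique_mapClusterPt (Eventually.of_forall hwV) fun v hv hcl => ?_
  refine huniq x v hv fun v' hv' => ?_
  obtain ⟨U, hU, hUv⟩ := mapClusterPt_iff_ultrafilter.1 hcl
  have hUx : Tendsto (fun x' : X => x') U (𝓝 x) := hU
  exact le_of_tendsto_of_tendsto ((hf.tendsto (x, v)).comp (hUx.prodMk_nhds hUv))
    ((hf.tendsto (x, v')).comp (hUx.prodMk_nhds tendsto_const_nhds))
    (Eventually.of_forall fun x' => hwmin x' v' hv')

/-- Envelope theorem: along a continuous selection of minimizers, the derivative of the minimal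
value is the partial derivative of the objective. -/
theorem HasStrictFDerivAt.hasFDerivAt_of_minimizer {E F : Type*}
    [NormedAddCommGroup E] [NormedSpace ℝ E] [NormedAddCommGroup F] [NormedSpace ℝ F]
    {V : Set F} {f : E × F → ℝ} {w : E → F} {y : E} {f' : E × F →L[ℝ] ℝ}
    (hf : HasStrictFDerivAt f f' (y, w y)) (hw : ContinuousAt w y)
    (hwV : ∀ x, w x ∈ V) (hwmin : ∀ x, ∀ v ∈ V, f (x, w x) ≤ f (x, v)) :
    HasFDerivAt (fun x => f (x, w x)) (f'.comp (ContinuousLinearMap.inl ℝ E F)) y := by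
  have increment {u : E → F} (hu : Tendsto u (𝓝 y) (𝓝 (w y))) :
      (fun x => f (x, u x) - f (y, u x) - f' (x - y, 0)) =o[𝓝 y] fun x => x - y := by
    have ht : Tendsto (fun x => ((x, u x), (y, u x))) (𝓝 y) (𝓝 ((y, w y), (y, w y))) :=
      (tendsto_id.prodMk_nhds hu).prodMk_nhds (tendsto_const_nhds.prodMk_nhds hu)
    have h := hf.isLittleO.comp_tendsto ht
    refine (h.congr_left fun x => by simp [-map_sub]).trans_isBigO ?_
    exact IsBigO.of_bound 1 (Eventually.of_forall fun x => by simp)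
  have hupper := increment (u := fun _ => w y) tendsto_const_nhds
  have hlower := increment hw
  refine HasFDerivAt.of_isLittleO
    ((IsBigO.of_bound 1 (Eventually.of_forall fun x => ?_)).trans_isLittleO
      (hupper.norm_left.add hlower.norm_left))
  have h₁ := hwmin x (w y) (hwV y)
  have h₂ := hwmin y (w x) (hwV x)
  simp only [ContinuousLinearMap.comp_apply, ContinuousLinearMap.inl_apply, Real.norm_eq_abs,
    one_mul]
  refine le_trans (abs_le.2 ⟨?_, ?_⟩) (le_abs_self _)
  · linarith [neg_abs_le (f (x, w x) - f (y, w x) - f' (x - y, 0)),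
      abs_nonneg (f (x, w y) - f (y, w y) - f' (x - y, 0))]
  · linarith [le_abs_self (f (x, w y) - f (y, w y) - f' (x - y, 0)),
      abs_nonneg (f (x, w x) - f (y, w x) - f' (x - y, 0))]

end EnvelopeTheorem

/-- Danskin-type envelope theorem: if `f` is continuously differentiable and for
every `y` the minimizer of `v ↦ f(y, v)` over the nonempty compact set `V` is
unique, then the value function `g(y) = min_{v ∈ V} f(y, v)` is continuously
differentiable, with `∇g(y) = ∇_y f(y, v(y))` where `v(y)` is the minimizer. -/
theorem value_function_gradient {n m : ℕ}
    (V : Set (EuclideanSpace ℝ (Fin m))) (hV : IsCompact V) (hVne : V.Nonempty)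
    (f : EuclideanSpace ℝ (Fin n) × EuclideanSpace ℝ (Fin m) → ℝ)
    (hf : ContDiff ℝ 1 f)
    (huniq : ∀ y : EuclideanSpace ℝ (Fin n),
      ∃! v, v ∈ V ∧ ∀ v' ∈ V, f (y, v) ≤ f (y, v')) :
    ContDiff ℝ 1 (fun y : EuclideanSpace ℝ (Fin n) => sInf ((fun v' => f (y, v')) '' V)) ∧
      ∀ (y : EuclideanSpace ℝ (Fin n)) (v : EuclideanSpace ℝ (Fin m)),
        (v ∈ V ∧ ∀ v' ∈ V, f (y, v) ≤ f (y, v')) →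
          gradient (fun y' : EuclideanSpace ℝ (Fin n) => sInf ((fun v' => f (y', v')) '' V)) y =
            gradient (fun y' : EuclideanSpace ℝ (Fin n) => f (y', v)) y := by
  choose w hw hwuniq using huniq
  have hwV : ∀ y, w y ∈ V := fun y => (hw y).1
  have hwmin : ∀ y, ∀ v ∈ V, f (y, w y) ≤ f (y, v) := fun y => (hw y).2
  have hwcont : Continuous w := continuous_of_unique_minimizer hV hf.continuous hwV hwmin
    fun y v hv hmin => hwuniq y v ⟨hv, hmin⟩
  have hvalue : (fun y => sInf ((fun v' => f (y, v')) '' V)) = fun y => f (y, w y) := by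
    funext y
    refine IsLeast.csInf_eq ⟨⟨w y, hwV y, rfl⟩, ?_⟩
    rintro _ ⟨v, hv, rfl⟩
    exact hwmin y v hv
  rw [hvalue]
  have hderiv : ∀ y, HasFDerivAt (fun x => f (x, w x))
      ((fderiv ℝ f (y, w y)).comp (ContinuousLinearMap.inl ℝ _ _)) y := fun y =>
    (hf.contDiffAt.hasStrictFDerivAt one_ne_zero).hasFDerivAt_of_minimizer
      hwcont.continuousAt hwV hwmin
  refine ⟨contDiff_one_iff_hasFDerivAt.2 ⟨_, ?_, hderiv⟩, fun y v hv => ?_⟩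
  · exact ((hf.continuous_fderiv one_ne_zero).comp (continuous_id.prodMk hwcont)).clm_comp
      continuous_const
  · obtain rfl := hwuniq y v hv
    have hpartial : HasFDerivAt (fun x => f (x, w y))
        ((fderiv ℝ f (y, w y)).comp (ContinuousLinearMap.inl ℝ _ _)) y :=
      (hf.differentiable one_ne_zero (y, w y)).hasFDerivAt.comp y (hasFDerivAt_prodMk_left y (w y))
    rw [gradient, gradient, (hderiv y).fderiv, hpartial.fderiv]
end
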